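/- arXiv:2107.07621 — 4 statements merged into one kernel-verified Lean document; each statement's English description precedes it below -/
import Mathlib

section
/- Let C be a category with finite limits and (E,M) a stable and proper orthogonal factorization system on C. For F-relations r : R → A×B, s : S → B×C, t : T → C×D, there is a unique isomorphism α : (R⊙S)⊙T → R⊙(S⊙T) commuting with the M-inclusions into A×D, i.e., such that the inclusion of R⊙(S⊙T) into A×D composed with α equals the inclusion of (R⊙S)⊙T into A×D. -/
open CategoryTheory CategoryTheory.Limits

universe v u

/-- An orthogonal factorization system on a category: a pair `(E, M)` of classes of
morphisms, each containing all isomorphisms and closed under composition, such that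
every morphism factors as an `E`-morphism followed by an `M`-morphism, and such that
every commutative square with an `E`-morphism on the left and an `M`-morphism on the
right admits a unique diagonal filler. -/
structure OFS (C : Type u) [Category.{v} C] where
  E : MorphismProperty C
  M : MorphismProperty C
  iso_mem_E : ∀ {X Y : C} (f : X ⟶ Y), IsIso f → E f
  iso_mem_M : ∀ {X Y : C} (f : X ⟶ Y), IsIso f → M f
  comp_mem_E : ∀ {X Y Z : C} (f : X ⟶ Y) (g : Y ⟶ Z), E f → E g → E (f ≫ g)
  comp_mem_M : ∀ {X Y Z : C} (f : X ⟶ Y) (g : Y ⟶ Z), M f → M g → M (f ≫ g)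
  fac : ∀ {X Y : C} (f : X ⟶ Y), ∃ (Z : C) (e : X ⟶ Z) (m : Z ⟶ Y), E e ∧ M m ∧ e ≫ m = f
  lift_unique : ∀ {A B X Y : C} (e : A ⟶ B) (m : X ⟶ Y) (u : A ⟶ X) (v : B ⟶ Y),
      E e → M m → e ≫ v = u ≫ m → ∃! w : B ⟶ X, e ≫ w = u ∧ w ≫ m = v


/-- An OFS is proper if every `E`-morphism is an epimorphism and every `M`-morphism is a
monomorphism. -/
def OFS.Proper {C : Type u} [Category.{v} C] (F : OFS C) : Prop :=
  (∀ {X Y : C} (f : X ⟶ Y), F.E f → Epi f) ∧ (∀ {X Y : C} (f : X ⟶ Y), F.M f → Mono f)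

/-- An OFS is stable if `E` is stable under pullback: whenever the pullback of an
`E`-morphism along some morphism exists, the pulled-back morphism again lies in `E`. -/
def OFS.Stable {C : Type u} [Category.{v} C] (F : OFS C) : Prop :=
  ∀ {P X Y Z : C} (p₁ : P ⟶ X) (p₂ : P ⟶ Y) (f : X ⟶ Z) (g : Y ⟶ Z),
    IsPullback p₁ p₂ f g → F.E g → F.E p₁

/-- Two `(E,M)`-factorizations of the same morphism are isomorphic. -/
theorem OFS.exists_iso_of_fac_eq {C : Type u} [Category.{v} C] (F : OFS C) {X Y I J : C}
    {e : X ⟶ I} {m : I ⟶ Y} {e' : X ⟶ J} {m' : J ⟶ Y} (he : F.E e) (hm : F.M m)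
    (he' : F.E e') (hm' : F.M m') (h : e ≫ m = e' ≫ m') : ∃ α : I ≅ J, α.hom ≫ m' = m := by
  obtain ⟨a, ⟨ha, ha'⟩, -⟩ := F.lift_unique e m' e' m he hm' h
  obtain ⟨b, ⟨hb, hb'⟩, -⟩ := F.lift_unique e' m e m' he' hm h.symm
  refine ⟨⟨a, b, ?_, ?_⟩, ha'⟩
  · exact (F.lift_unique e m e m he hm rfl).unique
      ⟨by rw [reassoc_of% ha, hb], by rw [Category.assoc, hb', ha']⟩ ⟨by simp, by simp⟩
  · exact (F.lift_unique e' m' e' m' he' hm' rfl).unique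
      ⟨by rw [reassoc_of% hb, ha], by rw [Category.assoc, ha', hb']⟩ ⟨by simp, by simp⟩

/-- For a stable OFS, base change along `p ∈ E` in the left factor of a fibre product gives a
morphism of `E`. -/
theorem OFS.Stable.exists_lift_left {C : Type u} [Category.{v} C] {F : OFS C} (hF : F.Stable)
    {P X X' Y Z : C} {x : P ⟶ X'} {y : P ⟶ Y} {p : X' ⟶ X} {f : X ⟶ Z} {g : Y ⟶ Z}
    [HasPullback f g] (h : IsPullback x y (p ≫ f) g) (hp : F.E p) :
    ∃ q : P ⟶ pullback f g,
      F.E q ∧ q ≫ pullback.fst f g = x ≫ p ∧ q ≫ pullback.snd f g = y := by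
  refine ⟨pullback.lift (x ≫ p) y (by simpa using h.w), ?_,
    pullback.lift_fst .., pullback.lift_snd ..⟩
  refine hF _ x (pullback.fst f g) p
    (IsPullback.of_right ?_ ?_ (IsPullback.of_hasPullback f g).flip) hp
  · rw [pullback.lift_snd]
    exact h.flip
  · rw [pullback.lift_fst]

/-- For a stable OFS, base change along `p ∈ E` in the right factor of a fibre product gives a
morphism of `E`. -/
theorem OFS.Stable.exists_lift_right {C : Type u} [Category.{v} C] {F : OFS C} (hF : F.Stable)
    {P X Y Y' Z : C} {x : P ⟶ X} {y : P ⟶ Y'} {p : Y' ⟶ Y} {f : X ⟶ Z} {g : Y ⟶ Z}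
    [HasPullback f g] (h : IsPullback x y f (p ≫ g)) (hp : F.E p) :
    ∃ q : P ⟶ pullback f g,
      F.E q ∧ q ≫ pullback.fst f g = x ∧ q ≫ pullback.snd f g = y ≫ p := by
  refine ⟨pullback.lift x (y ≫ p) (by simpa using h.w), ?_,
    pullback.lift_fst .., pullback.lift_snd ..⟩
  refine hF _ y (pullback.snd f g) p
    (IsPullback.of_right ?_ ?_ (IsPullback.of_hasPullback f g)) hp
  · rw [pullback.lift_fst]
    exact h
  · rw [pullback.lift_snd]

/-- Associativity of composition of `F`-relations with respect to a stable and proper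
orthogonal factorization system: for `F`-relations `r : R ⟶ A ⨯ B`, `s : S ⟶ B ⨯ C`,
`t : T ⟶ C ⨯ D` and chosen `(E,M)`-factorizations defining `R⊙S`, `S⊙T`, `(R⊙S)⊙T`
and `R⊙(S⊙T)`, there is a unique isomorphism `(R⊙S)⊙T ≅ R⊙(S⊙T)` commuting with the
`M`-inclusions into `A ⨯ D`. -/
theorem stmt8 {𝒞 : Type u} [Category.{v} 𝒞] [HasFiniteLimits 𝒞] (F : OFS 𝒞)
    (hstable : F.Stable) (hproper : F.Proper)
    {A B C D R S T : 𝒞}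
    (r : R ⟶ A ⨯ B) (hr : F.M r) (s : S ⟶ B ⨯ C) (hs : F.M s) (t : T ⟶ C ⨯ D) (ht : F.M t)
    -- chosen factorization defining R ⊙ S
    {RS : 𝒞} (pRS : pullback (r ≫ prod.snd) (s ≫ prod.fst) ⟶ RS) (hpRS : F.E pRS)
    (mRS : RS ⟶ A ⨯ C) (hmRS : F.M mRS)
    (hRS : pRS ≫ mRS =
      prod.lift (pullback.fst (r ≫ prod.snd) (s ≫ prod.fst) ≫ r ≫ prod.fst)
        (pullback.snd (r ≫ prod.snd) (s ≫ prod.fst) ≫ s ≫ prod.snd))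
    -- chosen factorization defining S ⊙ T
    {ST : 𝒞} (pST : pullback (s ≫ prod.snd) (t ≫ prod.fst) ⟶ ST) (hpST : F.E pST)
    (mST : ST ⟶ B ⨯ D) (hmST : F.M mST)
    (hST : pST ≫ mST =
      prod.lift (pullback.fst (s ≫ prod.snd) (t ≫ prod.fst) ≫ s ≫ prod.fst)
        (pullback.snd (s ≫ prod.snd) (t ≫ prod.fst) ≫ t ≫ prod.snd))
    -- chosen factorization defining (R ⊙ S) ⊙ T
    {RS_T : 𝒞} (pL : pullback (mRS ≫ prod.snd) (t ≫ prod.fst) ⟶ RS_T) (hpL : F.E pL)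
    (mL : RS_T ⟶ A ⨯ D) (hmL : F.M mL)
    (hL : pL ≫ mL =
      prod.lift (pullback.fst (mRS ≫ prod.snd) (t ≫ prod.fst) ≫ mRS ≫ prod.fst)
        (pullback.snd (mRS ≫ prod.snd) (t ≫ prod.fst) ≫ t ≫ prod.snd))
    -- chosen factorization defining R ⊙ (S ⊙ T)
    {R_ST : 𝒞} (pR : pullback (r ≫ prod.snd) (mST ≫ prod.fst) ⟶ R_ST) (hpR : F.E pR)
    (mR : R_ST ⟶ A ⨯ D) (hmR : F.M mR)
    (hR : pR ≫ mR =
      prod.lift (pullback.fst (r ≫ prod.snd) (mST ≫ prod.fst) ≫ r ≫ prod.fst)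
        (pullback.snd (r ≫ prod.snd) (mST ≫ prod.fst) ≫ mST ≫ prod.snd)) :
    ∃! α : RS_T ≅ R_ST, α.hom ≫ mR = mL := by
  have hRS₁ := hRS =≫ prod.fst
  have hRS₂ := hRS =≫ prod.snd
  have hST₁ := hST =≫ prod.fst
  have hST₂ := hST =≫ prod.snd
  simp only [Category.assoc, prod.lift_fst, prod.lift_snd] at hRS₁ hRS₂ hST₁ hST₂
  have hP := IsPullback.of_hasPullback (pullback.snd (r ≫ prod.snd) (s ≫ prod.fst))
    (pullback.fst (s ≫ prod.snd) (t ≫ prod.fst))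
  have hPL := hP.flip.paste_horiz
    (IsPullback.of_hasPullback (s ≫ prod.snd) (t ≫ prod.fst)).flip |>.flip
  have hPR := hP.paste_horiz (IsPullback.of_hasPullback (r ≫ prod.snd) (s ≫ prod.fst))
  rw [← hRS₂] at hPL
  rw [← hST₁] at hPR
  obtain ⟨qL, hqL, hqL₁, hqL₂⟩ := hstable.exists_lift_left hPL hpRS
  obtain ⟨qR, hqR, hqR₁, hqR₂⟩ := hstable.exists_lift_right hPR hpST
  obtain ⟨α, hα⟩ := F.exists_iso_of_fac_eq (F.comp_mem_E _ _ hqL hpL) hmL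
    (F.comp_mem_E _ _ hqR hpR) hmR (by
      simp [hL, hR, reassoc_of% hqL₁, reassoc_of% hqR₁, reassoc_of% hqL₂, reassoc_of% hqR₂,
        hRS₁, hST₂])
  have := hproper.2 mR hmR
  exact ⟨α, hα, fun β hβ => Iso.ext ((cancel_mono mR).1 (hβ.trans hα.symm))⟩
end

section
/- Let C be a category with finite limits and (E,M) a stable and proper orthogonal factorization system on C. Let e : A → B belong to E, and let r : R → B×X and s : S → A×X be F-relations. Then R ∧ ∃_{e×id_X}(S) and ∃_{e×id_X}((e×id_X)*R ∧ S) are equal as M-subobjects of B×X, where ∃_{e×id_X} denotes the M-image (the M-part of an (E,M)-factorization) of the composite with e×id_X, (e×id_X)*R denotes the pullback of the subobject r along e×id_X (which lies in M), and ∧ denotes intersection of subobjects computed by pullback. -/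
open CategoryTheory CategoryTheory.Limits

universe v u

/-- Frobenius law along an `E`-morphism: for `e : A ⟶ B` in `E` and `F`-relations
`r : R ⟶ B ⨯ X` and `s : S ⟶ A ⨯ X`, writing `g = e ⨯ 𝟙 X`, the subobjects
`R ∧ ∃_g(S)` and `∃_g(g*R ∧ S)` of `B ⨯ X` coincide: there is an isomorphism between
their domains commuting with the monomorphisms into `B ⨯ X`. Here `∃_g` is the
`M`-image (the `M`-part of a chosen `(E,M)`-factorization) of composition with `g`,
`g*R` is the pullback of `r` along `g`, and `∧` is intersection computed by pullback. -/
theorem stmt12 {𝒞 : Type u} [Category.{v} 𝒞] [HasFiniteLimits 𝒞] (F : OFS 𝒞)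
    (hstable : F.Stable) (hproper : F.Proper)
    {A B X R S : 𝒞} (e : A ⟶ B) (he : F.E e)
    (r : R ⟶ B ⨯ X) (hr : F.M r) (s : S ⟶ A ⨯ X) (hs : F.M s)
    -- chosen factorization defining the image ∃_{e ⨯ 𝟙 X}(S)
    {Sg : 𝒞} (eS : S ⟶ Sg) (mS : Sg ⟶ B ⨯ X) (heS : F.E eS) (hmS : F.M mS)
    (hfacS : eS ≫ mS = s ≫ prod.map e (𝟙 X))
    -- chosen factorization defining the image ∃_{e ⨯ 𝟙 X}((e ⨯ 𝟙 X)*R ∧ S)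
    {I : 𝒞} (eI : pullback (pullback.snd r (prod.map e (𝟙 X))) s ⟶ I)
    (mI : I ⟶ B ⨯ X) (heI : F.E eI) (hmI : F.M mI)
    (hfacI : eI ≫ mI =
      (pullback.fst (pullback.snd r (prod.map e (𝟙 X))) s ≫
        pullback.snd r (prod.map e (𝟙 X))) ≫ prod.map e (𝟙 X)) :
    ∃ j : pullback r mS ≅ I, j.hom ≫ mI = pullback.fst r mS ≫ r := by
  have : Mono r := hproper.2 r hr
  have : Mono mI := hproper.2 mI hmI
  -- the comparison `g*R ∧ S ⟶ R ∧ ∃_g(S)` is a pullback of `eS`, hence lies in `E`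
  have outer := (IsPullback.of_hasPullback (pullback.snd r (prod.map e (𝟙 X))) s).paste_horiz
    (IsPullback.of_hasPullback r (prod.map e (𝟙 X)))
  rw [← hfacS] at outer
  obtain ⟨q, hq₁, hq₂⟩ : ∃ q : pullback (pullback.snd r (prod.map e (𝟙 X))) s ⟶ pullback r mS,
      q ≫ pullback.fst r mS = pullback.fst _ _ ≫ pullback.fst _ _ ∧
      q ≫ pullback.snd r mS = pullback.snd _ _ ≫ eS :=
    ⟨pullback.lift _ _ (outer.w.trans (Category.assoc _ _ _).symm),
      pullback.lift_fst _ _ _, pullback.lift_snd _ _ _⟩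
  have hq : F.E q := by
    rw [← hq₁] at outer
    exact hstable _ _ _ _ (outer.of_right hq₂ (IsPullback.of_hasPullback r mS)) heS
  have hmIR : eI ≫ mI = (pullback.fst _ _ ≫ pullback.fst r (prod.map e (𝟙 X))) ≫ r := by
    rw [hfacI, Category.assoc, Category.assoc, pullback.condition]
  have hmIS : eI ≫ mI = (pullback.snd _ _ ≫ eS) ≫ mS := by
    rw [hmIR, Category.assoc _ eS, outer.w]
  obtain ⟨a, ⟨-, ha⟩, -⟩ := F.lift_unique eI r _ mI heI hr hmIR
  obtain ⟨b, ⟨-, hb⟩, -⟩ := F.lift_unique eI mS _ mI heI hmS hmIS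
  obtain ⟨j, ⟨-, hj⟩, -⟩ := F.lift_unique q mI eI (pullback.fst r mS ≫ r) hq hmI
    (by rw [hmIR, ← hq₁, Category.assoc])
  have : Mono mS := hproper.2 mS hmS
  have hk : pullback.lift a b (ha.trans hb.symm) ≫ pullback.fst r mS ≫ r = mI := by
    rw [pullback.lift_fst_assoc, ha]
  refine ⟨⟨j, pullback.lift a b (ha.trans hb.symm), ?_, ?_⟩, hj⟩
  · rw [← cancel_mono (pullback.fst r mS ≫ r), Category.assoc, hk, hj, Category.id_comp]
  · rw [← cancel_mono mI, Category.assoc, hj, hk, Category.id_comp]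
end

section
/- (Frobenius law for F-relations.) Let C be a category with finite limits and (E,M) a stable and proper orthogonal factorization system on C. Let f : A → B be any morphism of C, and let r : R → B×X and s : S → A×X be F-relations. Then R ∧ ∃_{f×id_X}(S) and ∃_{f×id_X}((f×id_X)*R ∧ S) are equal as M-subobjects of B×X, where ∃_{f×id_X} denotes the M-image (the M-part of an (E,M)-factorization) of the composite with f×id_X, (f×id_X)*R denotes the pullback of the subobject r along f×id_X (which lies in M), and ∧ denotes intersection of subobjects computed by pullback. -/
open CategoryTheory CategoryTheory.Limits

universe v u

namespace OFS

/-- If `s ≫ g = e ≫ m` with `e` in a pullback-stable `E`, then the pullback of `r` along `g`,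
restricted along `s`, maps by a morphism of `E` onto the pullback of `r` along `m`. -/
theorem Stable.exists_mem_E_pullback {C : Type u} [Category.{v} C] [HasPullbacks C] {F : OFS C}
    (hF : F.Stable) {Y Z R S T : C} (g : Y ⟶ Z) (r : R ⟶ Z) (s : S ⟶ Y)
    (e : S ⟶ T) (m : T ⟶ Z) (he : F.E e) (h : e ≫ m = s ≫ g) :
    ∃ d : pullback (pullback.snd r g) s ⟶ pullback r m, F.E d ∧
      d ≫ pullback.fst r m = pullback.fst (pullback.snd r g) s ≫ pullback.fst r g := by
  have outer := (IsPullback.of_hasPullback (pullback.snd r g) s).flip.paste_vert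
    (IsPullback.of_hasPullback r g).flip
  rw [← h] at outer
  let d : pullback (pullback.snd r g) s ⟶ pullback r m :=
    pullback.lift (pullback.fst (pullback.snd r g) s ≫ pullback.fst r g)
      (pullback.snd (pullback.snd r g) s ≫ e) (by simpa using outer.w.symm)
  have hd₁ : d ≫ pullback.fst r m = _ := pullback.lift_fst _ _ _
  have hd₂ : d ≫ pullback.snd r m = _ := pullback.lift_snd _ _ _
  have sq : IsPullback d (pullback.snd (pullback.snd r g) s) (pullback.snd r m) e := by
    refine IsPullback.of_right ?_ hd₂ (IsPullback.of_hasPullback r m)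
    rw [hd₁]
    exact outer.flip
  exact ⟨d, hF _ _ _ _ sq he, hd₁⟩

end OFS

/-- Frobenius law for `F`-relations: for any morphism `f : A ⟶ B` and `F`-relations
`r : R ⟶ B ⨯ X` and `s : S ⟶ A ⨯ X`, writing `g = f ⨯ 𝟙 X`, the subobjects
`R ∧ ∃_g(S)` and `∃_g(g*R ∧ S)` of `B ⨯ X` coincide: there is an isomorphism between
their domains commuting with the monomorphisms into `B ⨯ X`. Here `∃_g` is the
`M`-image (the `M`-part of a chosen `(E,M)`-factorization) of composition with `g`,
`g*R` is the pullback of `r` along `g`, and `∧` is intersection computed by pullback. -/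
theorem stmt13 {𝒞 : Type u} [Category.{v} 𝒞] [HasFiniteLimits 𝒞] (F : OFS 𝒞)
    (hstable : F.Stable) (hproper : F.Proper)
    {A B X R S : 𝒞} (f : A ⟶ B)
    (r : R ⟶ B ⨯ X) (hr : F.M r) (s : S ⟶ A ⨯ X) (hs : F.M s)
    -- chosen factorization defining the image ∃_{f ⨯ 𝟙 X}(S)
    {Sg : 𝒞} (eS : S ⟶ Sg) (mS : Sg ⟶ B ⨯ X) (heS : F.E eS) (hmS : F.M mS)
    (hfacS : eS ≫ mS = s ≫ prod.map f (𝟙 X))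
    -- chosen factorization defining the image ∃_{f ⨯ 𝟙 X}((f ⨯ 𝟙 X)*R ∧ S)
    {I : 𝒞} (eI : pullback (pullback.snd r (prod.map f (𝟙 X))) s ⟶ I)
    (mI : I ⟶ B ⨯ X) (heI : F.E eI) (hmI : F.M mI)
    (hfacI : eI ≫ mI =
      (pullback.fst (pullback.snd r (prod.map f (𝟙 X))) s ≫
        pullback.snd r (prod.map f (𝟙 X))) ≫ prod.map f (𝟙 X)) :
    ∃ j : pullback r mS ≅ I, j.hom ≫ mI = pullback.fst r mS ≫ r := by
  have := hproper.2 r hr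
  have := hproper.2 mS hmS
  have := hproper.2 mI hmI
  obtain ⟨d, hd, hd₁⟩ := hstable.exists_mem_E_pullback (prod.map f (𝟙 X)) r s eS mS heS hfacS
  obtain ⟨w, ⟨-, hw⟩, -⟩ := F.lift_unique d mI eI (pullback.fst r mS ≫ r) hd hmI (by
    rw [hfacI, reassoc_of% hd₁, Category.assoc, pullback.condition])
  obtain ⟨a, ⟨-, ha⟩, -⟩ := F.lift_unique eI r
    (pullback.fst (pullback.snd r (prod.map f (𝟙 X))) s ≫ pullback.fst _ _) mI heI hr (by
      rw [hfacI, Category.assoc, Category.assoc, pullback.condition])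
  obtain ⟨b, ⟨-, hb⟩, -⟩ := F.lift_unique eI mS
    (pullback.snd (pullback.snd r (prod.map f (𝟙 X))) s ≫ eS) mI heI hmS (by
      rw [hfacI, pullback.condition, Category.assoc, Category.assoc, hfacS])
  have hab : a ≫ r = b ≫ mS := ha.trans hb.symm
  refine ⟨⟨w, pullback.lift a b hab, ?_, ?_⟩, hw⟩
  · rw [← cancel_mono (pullback.fst r mS), ← cancel_mono r]
    simp only [Category.assoc, Category.id_comp, pullback.lift_fst_assoc, ha, hw]
  · rw [← cancel_mono mI]
    simp only [Category.assoc, Category.id_comp, pullback.lift_fst_assoc, ha, hw]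
end

section
/- Let C be a category with finite limits and (E,M) a proper orthogonal factorization system on C. For a morphism e : A → E of C, the following are equivalent: (i) e belongs to E; (ii) the M-image of the pairing ⟨e,e⟩ : A → E×E (i.e., the M-part of an (E,M)-factorization of ⟨e,e⟩) is equal, as a subobject of E×E, to the diagonal Δ_E : E → E×E. -/
open CategoryTheory CategoryTheory.Limits

universe v u

/-- For a proper orthogonal factorization system on a finitely complete category, a
morphism `e : A ⟶ B` lies in `E` if and only if the `M`-image of the pairing
`⟨e,e⟩ : A ⟶ B ⨯ B` (the `M`-part of any `(E,M)`-factorization of `⟨e,e⟩`) equals the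
diagonal `Δ_B : B ⟶ B ⨯ B` as a subobject of `B ⨯ B`, i.e. there is an isomorphism
between the domains commuting with the monomorphisms into `B ⨯ B`. -/
theorem stmt14 {𝒞 : Type u} [Category.{v} 𝒞] [HasFiniteLimits 𝒞] (F : OFS 𝒞)
    (hproper : F.Proper)
    {A B : 𝒞} (e : A ⟶ B) :
    F.E e ↔
      ∀ (Z : 𝒞) (p : A ⟶ Z) (m : Z ⟶ B ⨯ B),
        F.E p → F.M m → p ≫ m = prod.lift e e →
        ∃ j : Z ≅ B, j.hom ≫ prod.lift (𝟙 B) (𝟙 B) = m := by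
  constructor
  · intro he Z p m hp hm hpm
    obtain ⟨w, ⟨hew, hwm⟩, -⟩ := F.lift_unique e m p (prod.lift (𝟙 B) (𝟙 B)) he hm
      (by rw [hpm, prod.comp_lift, Category.comp_id])
    have := hproper.1 p hp
    have : Epi w := by
      have : Epi (e ≫ w) := by rwa [hew]
      exact epi_of_epi e w
    have : IsSplitMono w := ⟨⟨m ≫ prod.fst, by
      rw [← Category.assoc, hwm, prod.lift_fst]⟩⟩
    have : IsIso w := isIso_of_epi_of_isSplitMono w
    exact ⟨(asIso w).symm, by simp [← hwm]⟩
  · intro h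
    obtain ⟨Z, p, m, hp, hm, hpm⟩ := F.fac (prod.lift e e)
    obtain ⟨j, hj⟩ := h Z p m hp hm hpm
    have hpj : p ≫ j.hom = e := by
      rw [← prod.lift_fst e e, ← hpm, ← hj, Category.assoc, Category.assoc, prod.lift_fst,
        Category.comp_id]
    rw [← hpj]
    exact F.comp_mem_E p j.hom hp (F.iso_mem_E j.hom inferInstance)
end
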